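/- Let K be an (m+n)×(m+n) symmetric real matrix with generalized Cholesky factorization K = L·J_{m+n}·Lᵀ, where L is lower triangular with positive diagonal entries, and let ΔK be an (m+n)×(m+n) symmetric real matrix with ‖L⁻¹‖₂² · ‖ΔK‖_F < 1/2. If ΔL is a matrix such that L + ΔL is lower triangular with positive diagonal entries and K + ΔK = (L + ΔL)·J_{m+n}·(L + ΔL)ᵀ, then ‖L⁻¹·ΔL‖_F ≤ (1 − √(1 − 2·‖L⁻¹‖₂²·‖ΔK‖_F))/√2. -/

import Mathlib

open Matrix

noncomputable def frobNorm {k : ℕ} (A : Matrix (Fin k) (Fin k) ℝ) : ℝ :=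
  Real.sqrt (∑ i, ∑ j, (A i j) ^ 2)

noncomputable def specNorm {k : ℕ} (A : Matrix (Fin k) (Fin k) ℝ) : ℝ :=
  ‖Matrix.toEuclideanCLM (𝕜 := ℝ) A‖

noncomputable def kappa2 {k : ℕ} (A : Matrix (Fin k) (Fin k) ℝ) : ℝ :=
  specNorm A⁻¹ * specNorm A

noncomputable def upTri {k : ℕ} (A : Matrix (Fin k) (Fin k) ℝ) : Matrix (Fin k) (Fin k) ℝ :=
  Matrix.of fun i j => if i < j then A i j else if i = j then A i i / 2 else 0

noncomputable def Jmat (m n : ℕ) : Matrix (Fin (m + n)) (Fin (m + n)) ℝ :=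
  Matrix.diagonal fun i => if (i : ℕ) < m then 1 else -1

def IsLowerTri {k : ℕ} (A : Matrix (Fin k) (Fin k) ℝ) : Prop :=
  ∀ i j, i < j → A i j = 0

def IsUpperTri {k : ℕ} (A : Matrix (Fin k) (Fin k) ℝ) : Prop :=
  ∀ i j, j < i → A i j = 0

def PosDiag {k : ℕ} (A : Matrix (Fin k) (Fin k) ℝ) : Prop :=
  ∀ i, 0 < A i i

noncomputable def entAbs {k : ℕ} (A : Matrix (Fin k) (Fin k) ℝ) : Matrix (Fin k) (Fin k) ℝ :=
  Matrix.of fun i j => |A i j|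

noncomputable def condF {k : ℕ} (A : Matrix (Fin k) (Fin k) ℝ) : ℝ :=
  frobNorm (entAbs A⁻¹ * entAbs A)

section FrobeniusNorm

attribute [local instance] Matrix.frobeniusNormedAddCommGroup Matrix.frobeniusNormedSpace

theorem frobNorm_eq_norm {k : ℕ} (A : Matrix (Fin k) (Fin k) ℝ) : frobNorm A = ‖A‖ := by
  rw [frobNorm, Matrix.frobenius_norm_def, Real.sqrt_eq_rpow]
  simp

theorem norm_sq_eq_sum {k : ℕ} (A : Matrix (Fin k) (Fin k) ℝ) :
    ‖A‖ ^ 2 = ∑ i, ∑ j, (A i j) ^ 2 := by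
  rw [← frobNorm_eq_norm, frobNorm, Real.sq_sqrt]
  positivity

theorem abs_entry_le_norm {k : ℕ} (A : Matrix (Fin k) (Fin k) ℝ) (i j : Fin k) :
    |A i j| ≤ ‖A‖ := by
  refine abs_le_of_sq_le_sq ?_ (norm_nonneg A)
  rw [norm_sq_eq_sum]
  calc A i j ^ 2 ≤ ∑ j, A i j ^ 2 :=
        Finset.single_le_sum (f := fun j => A i j ^ 2) (fun _ _ => sq_nonneg _)
          (Finset.mem_univ j)
    _ ≤ _ := Finset.single_le_sum (f := fun i => ∑ j, A i j ^ 2)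
          (fun _ _ => Finset.sum_nonneg fun _ _ => sq_nonneg _) (Finset.mem_univ i)

theorem sum_sq_mulVec_le {k : ℕ} (A : Matrix (Fin k) (Fin k) ℝ) (v : Fin k → ℝ) :
    ∑ i, (A *ᵥ v) i ^ 2 ≤ specNorm A ^ 2 * ∑ i, v i ^ 2 := by
  have h := (Matrix.toEuclideanCLM (𝕜 := ℝ) A).le_opNorm (WithLp.toLp 2 v)
  have h2 := pow_le_pow_left₀ (norm_nonneg _) h 2
  rw [mul_pow, EuclideanSpace.norm_sq_eq, EuclideanSpace.norm_sq_eq] at h2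
  simpa [specNorm] using h2

theorem norm_mul_le_specNorm {k : ℕ} (A B : Matrix (Fin k) (Fin k) ℝ) :
    ‖A * B‖ ≤ specNorm A * ‖B‖ := by
  have hA : 0 ≤ specNorm A := norm_nonneg _
  apply le_of_sq_le_sq _ (by positivity)
  rw [mul_pow, norm_sq_eq_sum, norm_sq_eq_sum, Finset.sum_comm,
    Finset.sum_comm (f := fun i j => B i j ^ 2), Finset.mul_sum]
  exact Finset.sum_le_sum fun j _ => sum_sq_mulVec_le A fun i => B i j

theorem norm_mul_mul_transpose_le_specNorm {k : ℕ} (A B : Matrix (Fin k) (Fin k) ℝ) :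
    ‖A * B * Aᵀ‖ ≤ specNorm A ^ 2 * ‖B‖ := by
  have hA : 0 ≤ specNorm A := norm_nonneg _
  calc ‖A * B * Aᵀ‖ = ‖A * (B * Aᵀ)‖ := by rw [Matrix.mul_assoc]
    _ ≤ specNorm A * ‖B * Aᵀ‖ := norm_mul_le_specNorm _ _
    _ = specNorm A * ‖A * Bᵀ‖ := by
        rw [← Matrix.frobenius_norm_transpose (B * Aᵀ), Matrix.transpose_mul,
          Matrix.transpose_transpose]
    _ ≤ specNorm A * (specNorm A * ‖Bᵀ‖) := by gcongr; exact norm_mul_le_specNorm _ _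
    _ = specNorm A ^ 2 * ‖B‖ := by rw [Matrix.frobenius_norm_transpose]; ring

theorem upTri_sub {k : ℕ} (A B : Matrix (Fin k) (Fin k) ℝ) :
    upTri (A - B) = upTri A - upTri B := by
  ext i j
  simp only [upTri, Matrix.of_apply, Matrix.sub_apply]
  split_ifs <;> ring

theorem upTri_add_transpose {k : ℕ} {S : Matrix (Fin k) (Fin k) ℝ} (hS : Sᵀ = S) :
    upTri S + (upTri S)ᵀ = S := by
  ext i j
  have hij : S j i = S i j := congrFun (congrFun hS i) j
  rcases lt_trichotomy i j with h | rfl | h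
  · simp [upTri, h, h.ne', h.not_gt]
  · simp [upTri]
  · simp [upTri, h, h.ne', h.not_gt, hij]

theorem norm_upTri_le {k : ℕ} {S : Matrix (Fin k) (Fin k) ℝ} (hS : Sᵀ = S) :
    ‖upTri S‖ ≤ ‖S‖ / √2 := by
  rw [le_div_iff₀ (by positivity)]
  apply le_of_sq_le_sq _ (norm_nonneg _)
  have h : ‖upTri S‖ ^ 2 + ‖(upTri S)ᵀ‖ ^ 2 ≤ ‖S‖ ^ 2 := by
    simp only [norm_sq_eq_sum, ← Finset.sum_add_distrib]
    refine Finset.sum_le_sum fun i _ => Finset.sum_le_sum fun j _ => ?_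
    have hij : S j i = S i j := congrFun (congrFun hS i) j
    rcases lt_trichotomy i j with h | rfl | h
    · simp [upTri, h, h.ne', h.not_gt]
    · simp only [upTri, Matrix.of_apply, Matrix.transpose_apply, lt_irrefl, if_true, if_false]
      nlinarith [sq_nonneg (S i i)]
    · simp [upTri, h, h.ne', h.not_gt, hij]
  rw [Matrix.frobenius_norm_transpose] at h
  rw [mul_pow, Real.sq_sqrt zero_le_two]
  linarith

theorem Jmat_transpose (m n : ℕ) : (Jmat m n)ᵀ = Jmat m n :=
  Matrix.diagonal_transpose _

theorem Jmat_mul_self (m n : ℕ) : Jmat m n * Jmat m n = 1 := by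
  rw [Jmat, Matrix.diagonal_mul_diagonal, ← Matrix.diagonal_one]
  congr 1
  ext i
  split_ifs <;> norm_num

theorem norm_mul_Jmat {m n : ℕ} (A : Matrix (Fin (m + n)) (Fin (m + n)) ℝ) :
    ‖A * Jmat m n‖ = ‖A‖ := by
  rw [← sq_eq_sq₀ (norm_nonneg _) (norm_nonneg _), norm_sq_eq_sum, norm_sq_eq_sum]
  refine Finset.sum_congr rfl fun i _ => Finset.sum_congr rfl fun j _ => ?_
  rw [Jmat, Matrix.mul_diagonal]
  split_ifs <;> ring

theorem transpose_mul_Jmat_mul_transpose {m n : ℕ} (A : Matrix (Fin (m + n)) (Fin (m + n)) ℝ) :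
    (A * Jmat m n * Aᵀ)ᵀ = A * Jmat m n * Aᵀ := by
  simp [Matrix.transpose_mul, Jmat_transpose, Matrix.mul_assoc]

theorem norm_mul_Jmat_mul_le {m n : ℕ} (A B : Matrix (Fin (m + n)) (Fin (m + n)) ℝ) :
    ‖A * Jmat m n * B‖ ≤ ‖A‖ * ‖B‖ :=
  (Matrix.frobenius_norm_mul _ _).trans_eq (by rw [norm_mul_Jmat])

theorem norm_mul_Jmat_mul_transpose_sub_le {m n : ℕ}
    (A B : Matrix (Fin (m + n)) (Fin (m + n)) ℝ) :
    ‖A * Jmat m n * Aᵀ - B * Jmat m n * Bᵀ‖ ≤ (‖A‖ + ‖B‖) * ‖A - B‖ := by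
  have h : A * Jmat m n * Aᵀ - B * Jmat m n * Bᵀ =
      (A - B) * Jmat m n * Aᵀ + B * Jmat m n * (A - B)ᵀ := by
    rw [Matrix.transpose_sub]
    noncomm_ring
  rw [h]
  refine (norm_add_le _ _).trans ((add_le_add (norm_mul_Jmat_mul_le _ _)
    (norm_mul_Jmat_mul_le _ _)).trans_eq ?_)
  rw [Matrix.frobenius_norm_transpose, Matrix.frobenius_norm_transpose]
  ring

theorem IsLowerTri.blockTriangular {k : ℕ} {A : Matrix (Fin k) (Fin k) ℝ} (hA : IsLowerTri A) :
    A.BlockTriangular OrderDual.toDual :=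
  fun i j h => hA i j h

theorem Matrix.BlockTriangular.isLowerTri {k : ℕ} {A : Matrix (Fin k) (Fin k) ℝ}
    (hA : A.BlockTriangular OrderDual.toDual) : IsLowerTri A :=
  fun _ _ h => hA (OrderDual.toDual_lt_toDual.mpr h)

theorem IsLowerTri.mul {k : ℕ} {A B : Matrix (Fin k) (Fin k) ℝ} (hA : IsLowerTri A)
    (hB : IsLowerTri B) : IsLowerTri (A * B) :=
  (hA.blockTriangular.mul hB.blockTriangular).isLowerTri

theorem IsLowerTri.mul_apply_self {k : ℕ} {A B : Matrix (Fin k) (Fin k) ℝ} (hA : IsLowerTri A)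
    (hB : IsLowerTri B) (i : Fin k) : (A * B) i i = A i i * B i i := by
  rw [Matrix.mul_apply, Finset.sum_eq_single i _ (by simp)]
  intro j _ hj
  rcases hj.lt_or_gt with h | h
  · rw [hB j i h, mul_zero]
  · rw [hA i j h, zero_mul]

theorem IsLowerTri.isUnit_det {k : ℕ} {A : Matrix (Fin k) (Fin k) ℝ} (hA : IsLowerTri A)
    (hd : PosDiag A) : IsUnit A.det := by
  rw [Matrix.det_of_isLowerTriangular A hA.blockTriangular, isUnit_iff_ne_zero]
  exact Finset.prod_ne_zero_iff.mpr fun i _ => (hd i).ne'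

theorem IsLowerTri.inv {k : ℕ} {A : Matrix (Fin k) (Fin k) ℝ} (hA : IsLowerTri A)
    (hd : IsUnit A.det) : IsLowerTri A⁻¹ := by
  have := A.invertibleOfIsUnitDet hd
  exact (Matrix.blockTriangular_inv_of_blockTriangular hA.blockTriangular).isLowerTri

/-- A lower triangular matrix with positive diagonal that preserves the form `Jmat m n` is
the identity. -/
theorem IsLowerTri.eq_one_of_mul_Jmat_mul_transpose {m n : ℕ}
    {M : Matrix (Fin (m + n)) (Fin (m + n)) ℝ} (hM : IsLowerTri M) (hd : PosDiag M)
    (h : M * Jmat m n * Mᵀ = Jmat m n) : M = 1 := by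
  have hu := hM.isUnit_det hd
  have hJ : M * Jmat m n = Jmat m n * (M⁻¹)ᵀ := by
    conv_rhs => rw [← h]
    rw [Matrix.mul_assoc (M * Jmat m n), ← Matrix.transpose_mul,
      Matrix.nonsing_inv_mul _ hu, Matrix.transpose_one, Matrix.mul_one]
  have hlow : ∀ i j, j < i → M i j = 0 := by
    intro i j hij
    have h1 := congrFun (congrFun hJ i) j
    rw [Jmat, Matrix.mul_diagonal, Matrix.diagonal_mul, Matrix.transpose_apply,
      hM.inv hu j i hij, mul_zero] at h1
    split_ifs at h1 <;> linarith
  have hdiag : ∀ i, M i i = 1 := by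
    intro i
    have h1 := congrFun (congrFun h i) i
    rw [Matrix.mul_apply, Finset.sum_eq_single i _ (by simp), Jmat, Matrix.mul_diagonal,
      Matrix.transpose_apply, Matrix.diagonal_apply_eq] at h1
    · have h2 := hd i
      split_ifs at h1 <;> nlinarith
    · intro j _ hj
      rw [Matrix.transpose_apply]
      rcases hj.lt_or_gt with h | h
      · rw [hlow i j h, mul_zero]
      · rw [hM i j h, mul_zero]
  ext i j
  rcases lt_trichotomy i j with h | rfl | h
  · rw [hM i j h, Matrix.one_apply_ne h.ne]
  · rw [hdiag, Matrix.one_apply_eq]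
  · rw [hlow i j h, Matrix.one_apply_ne h.ne']

/-- Uniqueness of the generalized Cholesky factor with positive diagonal. -/
theorem IsLowerTri.eq_of_mul_Jmat_mul_transpose_eq {m n : ℕ}
    {P Q : Matrix (Fin (m + n)) (Fin (m + n)) ℝ} (hP : IsLowerTri P) (hPd : PosDiag P)
    (hQ : IsLowerTri Q) (hQd : PosDiag Q)
    (h : P * Jmat m n * Pᵀ = Q * Jmat m n * Qᵀ) : P = Q := by
  have hu := hQ.isUnit_det hQd
  have hM : IsLowerTri (Q⁻¹ * P) := (hQ.inv hu).mul hP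
  have hQM : Q * (Q⁻¹ * P) = P := Matrix.mul_nonsing_inv_cancel_left _ _ hu
  have hMd : PosDiag (Q⁻¹ * P) := fun i => by
    have h1 := hPd i
    rw [← hQM, hQ.mul_apply_self hM] at h1
    exact pos_of_mul_pos_right h1 (hQd i).le
  have hut : IsUnit (Qᵀ).det := by rwa [Matrix.det_transpose]
  have h1 : Q⁻¹ * P * Jmat m n * (Q⁻¹ * P)ᵀ = Jmat m n := by
    calc Q⁻¹ * P * Jmat m n * (Q⁻¹ * P)ᵀ = Q⁻¹ * (P * Jmat m n * Pᵀ) * (Qᵀ)⁻¹ := by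
          rw [Matrix.transpose_mul, Matrix.transpose_nonsing_inv]
          simp only [Matrix.mul_assoc]
      _ = (Q⁻¹ * Q) * Jmat m n * (Qᵀ * (Qᵀ)⁻¹) := by rw [h]; simp only [Matrix.mul_assoc]
      _ = Jmat m n := by
          rw [Matrix.nonsing_inv_mul _ hu, Matrix.mul_nonsing_inv _ hut, Matrix.one_mul,
            Matrix.mul_one]
  rw [← hQM, hM.eq_one_of_mul_Jmat_mul_transpose hMd h1, Matrix.mul_one]

/-- For a small symmetric perturbation `E` of `Jmat m n`, a contraction argument produces a
generalized Cholesky factor of `Jmat m n + E` close to the identity. -/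
theorem exists_isLowerTri_norm_le {m n : ℕ} {E : Matrix (Fin (m + n)) (Fin (m + n)) ℝ} {e : ℝ}
    (hE : Eᵀ = E) (hEe : ‖E‖ ≤ e) (he : e < 1 / 2) :
    ∃ Y : Matrix (Fin (m + n)) (Fin (m + n)) ℝ, IsLowerTri Y ∧
      (1 + Y) * Jmat m n * (1 + Y)ᵀ = Jmat m n + E ∧ ‖Y‖ ≤ (1 - √(1 - 2 * e)) / √2 := by
  set J := Jmat m n with hJ
  set r := (1 - √(1 - 2 * e)) / √2 with hr
  have he0 : 0 ≤ e := (norm_nonneg E).trans hEe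
  have hs2 : (0 : ℝ) < √2 := by positivity
  have hs2' : √2 * √2 = (2 : ℝ) := Real.mul_self_sqrt zero_le_two
  have hq : 0 < √(1 - 2 * e) := Real.sqrt_pos.mpr (by linarith)
  have hq1 : √(1 - 2 * e) ≤ 1 := Real.sqrt_le_one.mpr (by linarith)
  have hq2 : √(1 - 2 * e) * √(1 - 2 * e) = 1 - 2 * e := Real.mul_self_sqrt (by linarith)
  have hr0 : 0 ≤ r := div_nonneg (by linarith) hs2.le
  have hrs : r * √2 = 1 - √(1 - 2 * e) := div_mul_cancel₀ _ hs2.ne'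
  have hrr : e + r * r = r * √2 := by
    have h2 : 2 * (r * r) = (r * √2) * (r * √2) := by
      linear_combination -(r * r) * hs2'
    rw [hrs] at h2 ⊢
    nlinarith
  let f : Matrix (Fin (m + n)) (Fin (m + n)) ℝ → Matrix (Fin (m + n)) (Fin (m + n)) ℝ :=
    fun Y => (upTri (E - Y * J * Yᵀ))ᵀ * J
  have hsymm : ∀ Y : Matrix (Fin (m + n)) (Fin (m + n)) ℝ,
      (E - Y * J * Yᵀ)ᵀ = E - Y * J * Yᵀ := fun Y => by
    rw [Matrix.transpose_sub, hE, transpose_mul_Jmat_mul_transpose]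
  have hmaps : Set.MapsTo f (Metric.closedBall 0 r) (Metric.closedBall 0 r) := by
    intro Y hY
    rw [mem_closedBall_zero_iff] at hY ⊢
    calc ‖f Y‖ = ‖upTri (E - Y * J * Yᵀ)‖ := by
          rw [norm_mul_Jmat, Matrix.frobenius_norm_transpose]
      _ ≤ ‖E - Y * J * Yᵀ‖ / √2 := norm_upTri_le (hsymm Y)
      _ ≤ (‖E‖ + ‖Y‖ * ‖Y‖) / √2 := by
          gcongr
          refine (norm_sub_le _ _).trans (add_le_add_right ?_ _)
          exact (norm_mul_Jmat_mul_le _ _).trans_eq (by rw [Matrix.frobenius_norm_transpose])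
      _ ≤ (e + r * r) / √2 := by gcongr
      _ = r := by rw [hrr, mul_div_cancel_right₀ _ hs2.ne']
  have hlip : ∀ X ∈ Metric.closedBall (0 : Matrix (Fin (m + n)) (Fin (m + n)) ℝ) r,
      ∀ Y ∈ Metric.closedBall (0 : Matrix (Fin (m + n)) (Fin (m + n)) ℝ) r,
      dist (f X) (f Y) ≤ r * √2 * dist X Y := by
    intro X hX Y hY
    rw [mem_closedBall_zero_iff] at hX hY
    have hsub : f X - f Y = (upTri (Y * J * Yᵀ - X * J * Xᵀ))ᵀ * J := by
      simp only [f]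
      rw [← Matrix.sub_mul, ← Matrix.transpose_sub, ← upTri_sub, sub_sub_sub_cancel_left]
    rw [dist_eq_norm, dist_comm, dist_eq_norm, hsub, norm_mul_Jmat,
      Matrix.frobenius_norm_transpose]
    calc ‖upTri (Y * J * Yᵀ - X * J * Xᵀ)‖ ≤ ‖Y * J * Yᵀ - X * J * Xᵀ‖ / √2 :=
          norm_upTri_le (by
            rw [Matrix.transpose_sub, transpose_mul_Jmat_mul_transpose,
              transpose_mul_Jmat_mul_transpose])
      _ ≤ (‖Y‖ + ‖X‖) * ‖Y - X‖ / √2 := by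
          gcongr
          exact norm_mul_Jmat_mul_transpose_sub_le _ _
      _ ≤ (r + r) * ‖Y - X‖ / √2 := by gcongr
      _ = r * √2 * ‖Y - X‖ := by
          rw [div_eq_iff hs2.ne']
          linear_combination (-r * ‖Y - X‖) * hs2'
  obtain ⟨c, hc⟩ : ∃ c : NNReal, (c : ℝ) = r * √2 := ⟨⟨_, mul_nonneg hr0 hs2.le⟩, rfl⟩
  have hcontr : ContractingWith c (hmaps.restrict f _ _) := by
    refine ⟨?_, LipschitzWith.of_dist_le_mul fun X Y => ?_⟩
    · rw [← NNReal.coe_lt_coe, hc, NNReal.coe_one]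
      linarith
    · rw [hc]
      exact hlip X X.2 Y Y.2
  have : CompleteSpace (Matrix (Fin (m + n)) (Fin (m + n)) ℝ) := FiniteDimensional.complete ℝ _
  obtain ⟨Y, hYmem, hYfix, -⟩ := hcontr.exists_fixedPoint' Metric.isClosed_closedBall.isComplete
    hmaps (Metric.mem_closedBall_self hr0) (edist_ne_top _ _)
  have hYf : (upTri (E - Y * J * Yᵀ))ᵀ * J = Y := hYfix
  refine ⟨Y, ?_, ?_, mem_closedBall_zero_iff.mp hYmem⟩
  · intro i j hij
    rw [← hYf, hJ, Jmat, Matrix.mul_diagonal]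
    simp [upTri, hij.not_gt, hij.ne']
  · have h1 : Y * J = (upTri (E - Y * J * Yᵀ))ᵀ := by
      conv_lhs => rw [← hYf]
      rw [Matrix.mul_assoc, Jmat_mul_self, Matrix.mul_one]
    have h2 : J * Yᵀ = upTri (E - Y * J * Yᵀ) := by
      rw [← Matrix.transpose_transpose (upTri _), ← h1, Matrix.transpose_mul, Jmat_transpose]
    have h3 := upTri_add_transpose (hsymm Y)
    rw [← h1, ← h2] at h3
    calc (1 + Y) * J * (1 + Y)ᵀ = J + (J * Yᵀ + Y * J) + Y * J * Yᵀ := by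
          rw [Matrix.transpose_add, Matrix.transpose_one]
          noncomm_ring
      _ = J + E := by rw [h3]; abel

theorem norm_inv_mul_le_of_generalized_cholesky {m n : ℕ}
    {K L dK dL : Matrix (Fin (m + n)) (Fin (m + n)) ℝ}
    (hL : IsLowerTri L) (hLd : PosDiag L) (hfact : K = L * Jmat m n * Lᵀ) (hdK : dKᵀ = dK)
    (hsmall : specNorm L⁻¹ ^ 2 * ‖dK‖ < 1 / 2)
    (hL' : IsLowerTri (L + dL)) (hL'd : PosDiag (L + dL))
    (hfact' : K + dK = (L + dL) * Jmat m n * (L + dL)ᵀ) :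
    ‖L⁻¹ * dL‖ ≤ (1 - √(1 - 2 * (specNorm L⁻¹ ^ 2 * ‖dK‖))) / √2 := by
  have hu := hL.isUnit_det hLd
  have hut : IsUnit (Lᵀ).det := by rwa [Matrix.det_transpose]
  have hE : (L⁻¹ * dK * (L⁻¹)ᵀ)ᵀ = L⁻¹ * dK * (L⁻¹)ᵀ := by
    simp [Matrix.transpose_mul, hdK, Matrix.mul_assoc]
  obtain ⟨Y, hY, hYfact, hYn⟩ := exists_isLowerTri_norm_le hE
    (norm_mul_mul_transpose_le_specNorm _ _) hsmall
  have hY1 : ‖Y‖ < 1 := by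
    refine hYn.trans_lt ?_
    rw [div_lt_one (by positivity)]
    have h1 : (1 : ℝ) < √2 := Real.lt_sqrt_of_sq_lt (by norm_num)
    linarith [Real.sqrt_nonneg (1 - 2 * (specNorm L⁻¹ ^ 2 * ‖dK‖))]
  have hY' : IsLowerTri (1 + Y) := fun i j hij => by
    rw [Matrix.add_apply, hY i j hij, Matrix.one_apply_ne hij.ne, add_zero]
  have hYd : PosDiag (1 + Y) := fun i => by
    rw [Matrix.add_apply, Matrix.one_apply_eq]
    linarith [(abs_lt.mp ((abs_entry_le_norm Y i i).trans_lt hY1)).1]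
  have heq : L + dL = L * (1 + Y) := by
    refine hL'.eq_of_mul_Jmat_mul_transpose_eq hL'd (hL.mul hY')
      (fun i => by rw [hL.mul_apply_self hY']; exact mul_pos (hLd i) (hYd i)) ?_
    calc (L + dL) * Jmat m n * (L + dL)ᵀ = L * Jmat m n * Lᵀ + dK := by rw [← hfact', hfact]
      _ = L * Jmat m n * Lᵀ + (L * L⁻¹) * dK * ((Lᵀ)⁻¹ * Lᵀ) := by
          rw [Matrix.mul_nonsing_inv _ hu, Matrix.nonsing_inv_mul _ hut, Matrix.one_mul,
            Matrix.mul_one]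
      _ = L * (Jmat m n + L⁻¹ * dK * (L⁻¹)ᵀ) * Lᵀ := by
          rw [Matrix.transpose_nonsing_inv]
          noncomm_ring
      _ = L * (1 + Y) * Jmat m n * (L * (1 + Y))ᵀ := by
          rw [← hYfact, Matrix.transpose_mul]
          simp only [Matrix.mul_assoc]
  have hdL : dL = L * Y := by
    rw [Matrix.mul_add, Matrix.mul_one] at heq
    exact add_left_cancel heq
  rwa [hdL, Matrix.nonsing_inv_mul_cancel_left _ _ hu]

end FrobeniusNorm

theorem stmt10 (m n : ℕ) (K L dK dL : Matrix (Fin (m + n)) (Fin (m + n)) ℝ)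
    (hK : Kᵀ = K) (hL : IsLowerTri L) (hLd : PosDiag L)
    (hfact : K = L * Jmat m n * Lᵀ)
    (hdK : dKᵀ = dK)
    (hsmall : specNorm L⁻¹ ^ 2 * frobNorm dK < 1 / 2)
    (hL' : IsLowerTri (L + dL)) (hL'd : PosDiag (L + dL))
    (hfact' : K + dK = (L + dL) * Jmat m n * (L + dL)ᵀ) :
    frobNorm (L⁻¹ * dL) ≤
      (1 - Real.sqrt (1 - 2 * specNorm L⁻¹ ^ 2 * frobNorm dK)) / Real.sqrt 2 := by
  rw [frobNorm_eq_norm] at hsmall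
  rw [frobNorm_eq_norm, frobNorm_eq_norm, mul_assoc 2]
  exact norm_inv_mul_le_of_generalized_cholesky hL hLd hfact hdK hsmall hL' hL'd hfact'
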